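/- arXiv:1310.7643 — 3 statements merged into one kernel-verified Lean document; each statement's English description precedes it below -/
import Mathlib

section
/- Fix 0 < λ < 1 and y ≠ 0. In the backward variable, the λ-interface skew diffusion density solves the interface heat problem (the Markov process associated with the general interface condition is the rescaled skew Brownian motion with transmission parameter α(λ)): (i) for every t > 0 and every x ≠ 0, ∂q_λ/∂t (t,x,y) = (1/2)·D(x)·∂²q_λ/∂x² (t,x,y); (ii) for every t > 0, lim_{x↓0} q_λ(t,x,y) = lim_{x↑0} q_λ(t,x,y); (iii) for every t > 0, λ·lim_{x↓0} ∂q_λ/∂x (t,x,y) = (1−λ)·lim_{x↑0} ∂q_λ/∂x (t,x,y). -/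
open MeasureTheory Real Filter Topology

/-- The Gaussian heat kernel on `ℝ`. -/
noncomputable def gaussKernel (t z : ℝ) : ℝ :=
  (Real.sqrt (2 * Real.pi * t))⁻¹ * Real.exp (-z ^ 2 / (2 * t))

/-- The transition density of `α`-skew Brownian motion. -/
noncomputable def pSkew (α t x y : ℝ) : ℝ :=
  if 0 < x ∧ 0 < y then gaussKernel t (y - x) + (2 * α - 1) * gaussKernel t (y + x)
  else if x < 0 ∧ y ≤ 0 then gaussKernel t (y - x) - (2 * α - 1) * gaussKernel t (y + x)
  else if x ≤ 0 ∧ 0 < y then 2 * α * gaussKernel t (y - x)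
  else 2 * (1 - α) * gaussKernel t (y - x)

/-- The piecewise constant diffusion coefficient: `D⁺` for `x > 0`,
`D⁻` for `x ≤ 0`. -/
noncomputable def Dcoef (Dp Dm x : ℝ) : ℝ := if 0 < x then Dp else Dm

/-- The inverse of the rescaling map `s_{√D}`:
`s⁻¹(x) = x / √D⁺` for `x > 0` and `x / √D⁻` for `x ≤ 0`. -/
noncomputable def sInv (Dp Dm x : ℝ) : ℝ :=
  if 0 < x then x / Real.sqrt Dp else x / Real.sqrt Dm

/-- The transmission parameter associated with the interface parameter `λ`:
`α(λ) = λ√D⁻ / (λ√D⁻ + (1−λ)√D⁺)`. -/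
noncomputable def alphaOf (Dp Dm lam : ℝ) : ℝ :=
  lam * Real.sqrt Dm / (lam * Real.sqrt Dm + (1 - lam) * Real.sqrt Dp)

/-- The transition density of the `λ`-interface skew diffusion. -/
noncomputable def qLam (Dp Dm lam t x y : ℝ) : ℝ :=
  pSkew (alphaOf Dp Dm lam) t (sInv Dp Dm x) (sInv Dp Dm y) /
    Real.sqrt (Dcoef Dp Dm y)

theorem gK_hasDerivAt_z (t z : ℝ) (ht : 0 < t) :
    HasDerivAt (fun z => gaussKernel t z) (-(z / t) * gaussKernel t z) z := by
  unfold gaussKernel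
  have h1 : HasDerivAt (fun z : ℝ => -z ^ 2 / (2 * t)) (-(z / t)) z := by
    have := (((hasDerivAt_id z).pow 2).neg).div_const (2 * t)
    refine this.congr_deriv ?_
    simp
    field_simp
  refine (h1.exp.const_mul _).congr_deriv ?_
  ring

theorem gK_hasDerivAt_t (t z : ℝ) (ht : 0 < t) :
    HasDerivAt (fun s => gaussKernel s z)
      ((1 / 2) * (z ^ 2 / t ^ 2 - 1 / t) * gaussKernel t z) t := by
  unfold gaussKernel
  have hpos : 0 < 2 * Real.pi * t := by positivity
  have hs : 0 < Real.sqrt (2 * Real.pi * t) := Real.sqrt_pos.mpr hpos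
  have h1 : HasDerivAt (fun s : ℝ => -z ^ 2 / (2 * s)) (z ^ 2 / (2 * t ^ 2)) t := by
    have h0 : HasDerivAt (fun s : ℝ => 2 * s) 2 t := by
      simpa using (hasDerivAt_id t).const_mul (2 : ℝ)
    have := (hasDerivAt_const t (-z ^ 2)).div h0 (by positivity)
    refine this.congr_deriv ?_
    field_simp
    ring
  have h2 : HasDerivAt (fun s : ℝ => (Real.sqrt (2 * Real.pi * s))⁻¹)
      (-(1 / (2 * t)) * (Real.sqrt (2 * Real.pi * t))⁻¹) t := by
    have h0 : HasDerivAt (fun s : ℝ => 2 * Real.pi * s) (2 * Real.pi) t := by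
      simpa using (hasDerivAt_id t).const_mul (2 * Real.pi)
    have := (h0.sqrt hpos.ne').inv hs.ne'
    refine this.congr_deriv ?_
    rw [Real.sq_sqrt hpos.le]
    field_simp
  refine (h2.mul h1.exp).congr_deriv ?_
  field_simp
  ring

/-- generic combination -/
noncomputable def Fcomb (A B b k t x : ℝ) : ℝ :=
  A * gaussKernel t (b - x / k) + B * gaussKernel t (b + x / k)

noncomputable def Fcomb1 (A B b k t x : ℝ) : ℝ :=
  A * ((b - x / k) / (t * k) * gaussKernel t (b - x / k))
    - B * ((b + x / k) / (t * k) * gaussKernel t (b + x / k))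

noncomputable def Fcomb2 (A B b k t x : ℝ) : ℝ :=
  (A * (((b - x / k) ^ 2 / t ^ 2 - 1 / t) * gaussKernel t (b - x / k))
    + B * (((b + x / k) ^ 2 / t ^ 2 - 1 / t) * gaussKernel t (b + x / k))) / k ^ 2

theorem lin_sub (b k x : ℝ) : HasDerivAt (fun x : ℝ => b - x / k) (-(1 / k)) x := by
  simpa using ((hasDerivAt_id x).div_const k).const_sub b

theorem lin_add (b k x : ℝ) : HasDerivAt (fun x : ℝ => b + x / k) (1 / k) x := by
  simpa using ((hasDerivAt_id x).div_const k).const_add b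

theorem gK_sub (b k t x : ℝ) (ht : 0 < t) :
    HasDerivAt (fun x : ℝ => gaussKernel t (b - x / k))
      (-((b - x / k) / t) * gaussKernel t (b - x / k) * (-(1 / k))) x :=
  HasDerivAt.comp (h₂ := fun z => gaussKernel t z) (h := fun x : ℝ => b - x / k) x
    (gK_hasDerivAt_z t (b - x / k) ht) (lin_sub b k x)

theorem gK_add (b k t x : ℝ) (ht : 0 < t) :
    HasDerivAt (fun x : ℝ => gaussKernel t (b + x / k))
      (-((b + x / k) / t) * gaussKernel t (b + x / k) * (1 / k)) x :=
  HasDerivAt.comp (h₂ := fun z => gaussKernel t z) (h := fun x : ℝ => b + x / k) x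
    (gK_hasDerivAt_z t (b + x / k) ht) (lin_add b k x)

theorem Fcomb_x (A B b k t x : ℝ) (hk : 0 < k) (ht : 0 < t) :
    HasDerivAt (fun x => Fcomb A B b k t x) (Fcomb1 A B b k t x) x := by
  unfold Fcomb Fcomb1
  refine (((gK_sub b k t x ht).const_mul A).add ((gK_add b k t x ht).const_mul B)).congr_deriv ?_
  field_simp
  ring

theorem Fcomb1_x (A B b k t x : ℝ) (hk : 0 < k) (ht : 0 < t) :
    HasDerivAt (fun x => Fcomb1 A B b k t x) (Fcomb2 A B b k t x) x := by
  unfold Fcomb1 Fcomb2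
  refine (((((lin_sub b k x).div_const (t * k)).mul (gK_sub b k t x ht)).const_mul A).sub
    ((((lin_add b k x).div_const (t * k)).mul (gK_add b k t x ht)).const_mul B)).congr_deriv ?_
  generalize gaussKernel t (b - x / k) = u
  generalize gaussKernel t (b + x / k) = v
  field_simp
  ring

theorem Fcomb_t (A B b k t x : ℝ) (hk : 0 < k) (ht : 0 < t) :
    HasDerivAt (fun s => Fcomb A B b k s x) ((1 / 2) * k ^ 2 * Fcomb2 A B b k t x) t := by
  unfold Fcomb Fcomb2
  refine (((gK_hasDerivAt_t t (b - x / k) ht).const_mul A).add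
    ((gK_hasDerivAt_t t (b + x / k) ht).const_mul B)).congr_deriv ?_
  generalize gaussKernel t (b - x / k) = u
  generalize gaussKernel t (b + x / k) = v
  field_simp

theorem deriv_eq_on {f g g' : ℝ → ℝ} {S : Set ℝ} (hS : IsOpen S) (h : ∀ x ∈ S, f x = g x)
    (hg : ∀ x, HasDerivAt g (g' x) x) : ∀ x ∈ S, deriv f x = g' x := by
  intro x hx
  have : f =ᶠ[𝓝 x] g := by
    filter_upwards [hS.mem_nhds hx] with z hz using h z hz
  rw [this.deriv_eq, (hg x).deriv]

theorem qLam_rep (Dp Dm : ℝ) (hDp : 0 < Dp) (hDm : 0 < Dm)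
    (lam : ℝ) (hlam₀ : 0 < lam) (hlam₁ : lam < 1) (y : ℝ) (hy : y ≠ 0) :
    ∃ b A B A' B' : ℝ,
      (∀ t x, 0 < x → qLam Dp Dm lam t x y = Fcomb A B b (Real.sqrt Dp) t x) ∧
      (∀ t x, x < 0 → qLam Dp Dm lam t x y = Fcomb A' B' b (Real.sqrt Dm) t x) ∧
      A + B = A' + B' ∧
      lam * ((A - B) / Real.sqrt Dp) = (1 - lam) * ((A' - B') / Real.sqrt Dm) := by
  have hp : 0 < Real.sqrt Dp := Real.sqrt_pos.mpr hDp
  have hm : 0 < Real.sqrt Dm := Real.sqrt_pos.mpr hDm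
  have hl : 0 < 1 - lam := by linarith
  have hden : 0 < lam * Real.sqrt Dm + (1 - lam) * Real.sqrt Dp := by positivity
  have ha : lam * (1 - alphaOf Dp Dm lam) / Real.sqrt Dp
      = (1 - lam) * alphaOf Dp Dm lam / Real.sqrt Dm := by
    unfold alphaOf
    field_simp
    ring
  set a := alphaOf Dp Dm lam with hadef
  rcases lt_or_gt_of_ne hy with h | h
  · have hy' : y / Real.sqrt Dm < 0 := div_neg_of_neg_of_pos h hm
    refine ⟨y / Real.sqrt Dm, 2 * (1 - a) / Real.sqrt Dm, 0, 1 / Real.sqrt Dm,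
      -(2 * a - 1) / Real.sqrt Dm, ?_, ?_, by ring, ?_⟩
    · intro t x hx
      have hx' : 0 < x / Real.sqrt Dp := div_pos hx hp
      simp only [qLam, pSkew, sInv, Dcoef, Fcomb, if_pos hx, if_neg h.le.not_gt, ← hadef,
        hx', hy'.not_gt, hx'.not_gt, hx'.not_ge, and_false, false_and, if_false]
      ring
    · intro t x hx
      have hx' : x / Real.sqrt Dm < 0 := div_neg_of_neg_of_pos hx hm
      simp only [qLam, pSkew, sInv, Dcoef, Fcomb, if_neg hx.not_gt, if_neg h.not_gt, ← hadef,
        hx', hy'.not_gt, hy'.le, and_false, and_self, if_false, if_true]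
      ring
    · linear_combination (2 / Real.sqrt Dm) * ha
  · have hy' : 0 < y / Real.sqrt Dp := div_pos h hp
    refine ⟨y / Real.sqrt Dp, 1 / Real.sqrt Dp, (2 * a - 1) / Real.sqrt Dp,
      2 * a / Real.sqrt Dp, 0, ?_, ?_, by ring, ?_⟩
    · intro t x hx
      have hx' : 0 < x / Real.sqrt Dp := div_pos hx hp
      simp only [qLam, pSkew, sInv, Dcoef, Fcomb, if_pos hx, if_pos h, ← hadef,
        hx', hy', and_self, if_true]
      ring
    · intro t x hx
      have hx' : x / Real.sqrt Dm < 0 := div_neg_of_neg_of_pos hx hm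
      simp only [qLam, pSkew, sInv, Dcoef, Fcomb, if_neg hx.not_gt, if_pos h, ← hadef,
        hx'.le, hx'.not_gt, hy', hy'.not_ge, and_false, false_and, and_self, if_false, if_true]
      ring
    · linear_combination (2 / Real.sqrt Dp) * ha

/-- for fixed `y ≠ 0`, in the backward variable the
`λ`-interface skew diffusion density solves the interface heat problem:
(i) the heat equation with coefficient `D(x)/2` away from the interface,
(ii) continuity across the interface, and (iii) the `λ`-interface condition
`λ·∂q/∂x(t,0⁺,y) = (1−λ)·∂q/∂x(t,0⁻,y)`. -/
theorem qLam_backward_interface_problem (Dp Dm : ℝ) (hDp : 0 < Dp) (hDm : 0 < Dm)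
    (lam : ℝ) (hlam₀ : 0 < lam) (hlam₁ : lam < 1) (y : ℝ) (hy : y ≠ 0) :
    (∀ t : ℝ, 0 < t → ∀ x : ℝ, x ≠ 0 →
      deriv (fun s : ℝ => qLam Dp Dm lam s x y) t =
        (1 / 2) * Dcoef Dp Dm x *
          deriv (deriv (fun x' : ℝ => qLam Dp Dm lam t x' y)) x) ∧
    (∀ t : ℝ, 0 < t → ∃ c : ℝ,
      Filter.Tendsto (fun x : ℝ => qLam Dp Dm lam t x y)
        (nhdsWithin 0 (Set.Ioi 0)) (nhds c) ∧
      Filter.Tendsto (fun x : ℝ => qLam Dp Dm lam t x y)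
        (nhdsWithin 0 (Set.Iio 0)) (nhds c)) ∧
    (∀ t : ℝ, 0 < t → ∃ gp gm : ℝ,
      Filter.Tendsto (deriv (fun x' : ℝ => qLam Dp Dm lam t x' y))
        (nhdsWithin 0 (Set.Ioi 0)) (nhds gp) ∧
      Filter.Tendsto (deriv (fun x' : ℝ => qLam Dp Dm lam t x' y))
        (nhdsWithin 0 (Set.Iio 0)) (nhds gm) ∧
      lam * gp = (1 - lam) * gm) := by
  have hp : 0 < Real.sqrt Dp := Real.sqrt_pos.mpr hDp
  have hm : 0 < Real.sqrt Dm := Real.sqrt_pos.mpr hDm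
  obtain ⟨b, A, B, A', B', hP, hM, h0, h1⟩ := qLam_rep Dp Dm hDp hDm lam hlam₀ hlam₁ y hy
  have dP : ∀ t, 0 < t → ∀ x ∈ Set.Ioi (0 : ℝ),
      deriv (fun x' : ℝ => qLam Dp Dm lam t x' y) x = Fcomb1 A B b (Real.sqrt Dp) t x :=
    fun t ht => deriv_eq_on isOpen_Ioi (fun x hx => hP t x hx)
      (fun x => Fcomb_x A B b _ t x hp ht)
  have dM : ∀ t, 0 < t → ∀ x ∈ Set.Iio (0 : ℝ),
      deriv (fun x' : ℝ => qLam Dp Dm lam t x' y) x = Fcomb1 A' B' b (Real.sqrt Dm) t x :=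
    fun t ht => deriv_eq_on isOpen_Iio (fun x hx => hM t x hx)
      (fun x => Fcomb_x A' B' b _ t x hm ht)
  refine ⟨?_, ?_, ?_⟩
  · intro t ht x hx
    rcases lt_or_gt_of_ne hx with h | h
    · rw [deriv_eq_on isOpen_Iio (dM t ht) (fun x => Fcomb1_x A' B' b _ t x hm ht) x h]
      simp only [fun s => hM s x h]
      rw [(Fcomb_t A' B' b _ t x hm ht).deriv, Real.sq_sqrt hDm.le, Dcoef, if_neg h.not_gt]
    · rw [deriv_eq_on isOpen_Ioi (dP t ht) (fun x => Fcomb1_x A B b _ t x hp ht) x h]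
      simp only [fun s => hP s x h]
      rw [(Fcomb_t A B b _ t x hp ht).deriv, Real.sq_sqrt hDp.le, Dcoef, if_pos h]
  · intro t ht
    refine ⟨Fcomb A B b (Real.sqrt Dp) t 0, ?_, ?_⟩
    · refine ((Fcomb_x A B b _ t 0 hp ht).continuousAt.tendsto.mono_left
        nhdsWithin_le_nhds).congr' ?_
      filter_upwards [self_mem_nhdsWithin] with x hx using (hP t x hx).symm
    · have e : Fcomb A B b (Real.sqrt Dp) t 0 = Fcomb A' B' b (Real.sqrt Dm) t 0 := by
        simp only [Fcomb, zero_div, sub_zero, add_zero]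
        linear_combination gaussKernel t b * h0
      rw [e]
      refine ((Fcomb_x A' B' b _ t 0 hm ht).continuousAt.tendsto.mono_left
        nhdsWithin_le_nhds).congr' ?_
      filter_upwards [self_mem_nhdsWithin] with x hx using (hM t x hx).symm
  · intro t ht
    refine ⟨Fcomb1 A B b (Real.sqrt Dp) t 0, Fcomb1 A' B' b (Real.sqrt Dm) t 0, ?_, ?_, ?_⟩
    · refine ((Fcomb1_x A B b _ t 0 hp ht).continuousAt.tendsto.mono_left
        nhdsWithin_le_nhds).congr' ?_
      filter_upwards [self_mem_nhdsWithin] with x hx using (dP t ht x hx).symm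
    · refine ((Fcomb1_x A' B' b _ t 0 hm ht).continuousAt.tendsto.mono_left
        nhdsWithin_le_nhds).congr' ?_
      filter_upwards [self_mem_nhdsWithin] with x hx using (dM t ht x hx).symm
    · simp only [Fcomb1, zero_div, sub_zero, add_zero]
      linear_combination (b / t * gaussKernel t b) * h1
end

section
/- (Characterization of the conservative interface condition by continuity of the forward density, the density-level analogue of continuity of natural local time.) Fix 0 < λ < 1. For every t > 0 and every x ∈ ℝ, the one-sided limits lim_{y↓0} q_λ(t,x,y) and lim_{y↑0} q_λ(t,x,y) exist, and they are equal for all t > 0 and x ∈ ℝ if and only if λ = D⁺/(D⁺+D⁻). -/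
open MeasureTheory Real Filter Topology

lemma gaussKernel_continuous (t : ℝ) : Continuous (gaussKernel t) := by
  unfold gaussKernel
  fun_prop

lemma gaussKernel_neg (t z : ℝ) : gaussKernel t (-z) = gaussKernel t z := by
  simp [gaussKernel]

lemma gaussKernel_pos (t z : ℝ) (ht : 0 < t) : 0 < gaussKernel t z := by
  unfold gaussKernel
  have := Real.pi_pos
  positivity

lemma tendsto_gauss_sub (t X c : ℝ) (s : Set ℝ) :
    Tendsto (fun y : ℝ => gaussKernel t (y / c - X)) (𝓝[s] 0) (𝓝 (gaussKernel t X)) := by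
  have hc : Continuous (fun y : ℝ => gaussKernel t (y / c - X)) :=
    (gaussKernel_continuous t).comp (by fun_prop)
  have h := (hc.tendsto 0).mono_left (nhdsWithin_le_nhds (s := s))
  simpa [gaussKernel_neg] using h

lemma tendsto_gauss_add (t X c : ℝ) (s : Set ℝ) :
    Tendsto (fun y : ℝ => gaussKernel t (y / c + X)) (𝓝[s] 0) (𝓝 (gaussKernel t X)) := by
  simpa [gaussKernel_neg] using tendsto_gauss_sub t (-X) c s

lemma qLam_tendsto_right (Dp Dm : ℝ) (hDp : 0 < Dp) (lam t x : ℝ) :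
    Tendsto (fun y : ℝ => qLam Dp Dm lam t x y) (𝓝[>] 0)
      (𝓝 (2 * alphaOf Dp Dm lam * gaussKernel t (sInv Dp Dm x) / Real.sqrt Dp)) := by
  have hs := Real.sqrt_pos.2 hDp
  set X := sInv Dp Dm x with hX
  set a := alphaOf Dp Dm lam with ha
  rcases lt_or_ge 0 X with h | h
  · have h1 : Tendsto (fun y : ℝ => (gaussKernel t (y / √Dp - X) +
        (2 * a - 1) * gaussKernel t (y / √Dp + X)) / √Dp) (𝓝[>] 0)
        (𝓝 ((gaussKernel t X + (2 * a - 1) * gaussKernel t X) / √Dp)) :=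
      ((tendsto_gauss_sub t X _ _).add ((tendsto_gauss_add t X _ _).const_mul _)).div_const _
    have e : 2 * a * gaussKernel t X / √Dp =
        (gaussKernel t X + (2 * a - 1) * gaussKernel t X) / √Dp := by ring
    rw [e]
    refine h1.congr' ?_
    filter_upwards [self_mem_nhdsWithin] with y hy
    have hy : 0 < y := hy
    have hy2 : 0 < y / √Dp := by positivity
    simp only [qLam, ← hX, ← ha]
    rw [show sInv Dp Dm y = y / √Dp by simp [sInv, hy], pSkew, if_pos ⟨h, hy2⟩]
    simp [Dcoef, hy]
  · refine (((tendsto_gauss_sub t X (√Dp) _).const_mul (2 * a)).div_const (√Dp)).congr' ?_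
    filter_upwards [self_mem_nhdsWithin] with y hy
    have hy : 0 < y := hy
    have hy2 : 0 < y / √Dp := by positivity
    simp only [qLam, ← hX, ← ha]
    rw [show sInv Dp Dm y = y / √Dp by simp [sInv, hy], pSkew, if_neg (fun k => h.not_gt k.1),
      if_neg (fun k => k.2.not_gt hy2), if_pos ⟨h, hy2⟩]
    simp [Dcoef, hy]

lemma qLam_tendsto_left (Dp Dm : ℝ) (hDm : 0 < Dm) (lam t x : ℝ) :
    Tendsto (fun y : ℝ => qLam Dp Dm lam t x y) (𝓝[<] 0)
      (𝓝 (2 * (1 - alphaOf Dp Dm lam) * gaussKernel t (sInv Dp Dm x) / Real.sqrt Dm)) := by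
  have hs := Real.sqrt_pos.2 hDm
  set X := sInv Dp Dm x with hX
  set a := alphaOf Dp Dm lam with ha
  rcases lt_or_ge X 0 with h | h
  · have h1 : Tendsto (fun y : ℝ => (gaussKernel t (y / √Dm - X) -
        (2 * a - 1) * gaussKernel t (y / √Dm + X)) / √Dm) (𝓝[<] 0)
        (𝓝 ((gaussKernel t X - (2 * a - 1) * gaussKernel t X) / √Dm)) :=
      ((tendsto_gauss_sub t X _ _).sub ((tendsto_gauss_add t X _ _).const_mul _)).div_const _
    have e : 2 * (1 - a) * gaussKernel t X / √Dm =
        (gaussKernel t X - (2 * a - 1) * gaussKernel t X) / √Dm := by ring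
    rw [e]
    refine h1.congr' ?_
    filter_upwards [self_mem_nhdsWithin] with y hy
    have hy : y < 0 := hy
    have hy2 : y / √Dm < 0 := div_neg_of_neg_of_pos hy hs
    simp only [qLam, ← hX, ← ha]
    rw [show sInv Dp Dm y = y / √Dm by simp [sInv, hy.not_gt], pSkew,
      if_neg (fun k => h.not_gt k.1), if_pos ⟨h, hy2.le⟩]
    simp [Dcoef, hy.not_gt]
  · refine (((tendsto_gauss_sub t X (√Dm) _).const_mul (2 * (1 - a))).div_const (√Dm)).congr' ?_
    filter_upwards [self_mem_nhdsWithin] with y hy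
    have hy : y < 0 := hy
    have hy2 : y / √Dm < 0 := div_neg_of_neg_of_pos hy hs
    simp only [qLam, ← hX, ← ha]
    rw [show sInv Dp Dm y = y / √Dm by simp [sInv, hy.not_gt], pSkew,
      if_neg (fun k => hy2.not_gt k.2), if_neg (fun k => h.not_gt k.1),
      if_neg (fun k => hy2.not_gt k.2)]
    simp [Dcoef, hy.not_gt]

lemma alpha_balance_iff (Dp Dm : ℝ) (hDp : 0 < Dp) (hDm : 0 < Dm)
    (lam : ℝ) (hlam₀ : 0 < lam) (hlam₁ : lam < 1) (g : ℝ) (hg : 0 < g) :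
    2 * alphaOf Dp Dm lam * g / √Dp = 2 * (1 - alphaOf Dp Dm lam) * g / √Dm ↔
      lam = Dp / (Dp + Dm) := by
  have hp := Real.sqrt_pos.2 hDp
  have hm := Real.sqrt_pos.2 hDm
  have ep := Real.mul_self_sqrt hDp.le
  have em := Real.mul_self_sqrt hDm.le
  unfold alphaOf
  set p := √Dp
  set m := √Dm
  have h1 : 0 < 1 - lam := by linarith
  have hd : 0 < lam * m + (1 - lam) * p := by positivity
  have e1 : 2 * (lam * m / (lam * m + (1 - lam) * p)) * g / p =
      (2 * g / (lam * m + (1 - lam) * p)) * (lam * m / p) := by field_simp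
  have e2 : 2 * (1 - lam * m / (lam * m + (1 - lam) * p)) * g / m =
      (2 * g / (lam * m + (1 - lam) * p)) * ((1 - lam) * p / m) := by
    field_simp
    ring
  have hne : 2 * g / (lam * m + (1 - lam) * p) ≠ 0 := by positivity
  rw [e1, e2, mul_right_inj' hne, div_eq_div_iff hp.ne' hm.ne', eq_div_iff (by positivity),
    ← ep, ← em]
  constructor <;> intro h <;> linarith

/-- the one-sided limits of the forward density at the
interface always exist, and they agree for all `t > 0`, `x ∈ ℝ` if and only
if `λ = D⁺/(D⁺ + D⁻)` (the conservative interface condition). -/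
theorem qLam_forward_continuity_iff_conservative (Dp Dm : ℝ)
    (hDp : 0 < Dp) (hDm : 0 < Dm)
    (lam : ℝ) (hlam₀ : 0 < lam) (hlam₁ : lam < 1) :
    (∀ t : ℝ, 0 < t → ∀ x : ℝ, ∃ Lp Lm : ℝ,
      Filter.Tendsto (fun y : ℝ => qLam Dp Dm lam t x y)
        (nhdsWithin 0 (Set.Ioi 0)) (nhds Lp) ∧
      Filter.Tendsto (fun y : ℝ => qLam Dp Dm lam t x y)
        (nhdsWithin 0 (Set.Iio 0)) (nhds Lm)) ∧
    ((∀ t : ℝ, 0 < t → ∀ x : ℝ, ∃ L : ℝ,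
      Filter.Tendsto (fun y : ℝ => qLam Dp Dm lam t x y)
        (nhdsWithin 0 (Set.Ioi 0)) (nhds L) ∧
      Filter.Tendsto (fun y : ℝ => qLam Dp Dm lam t x y)
        (nhdsWithin 0 (Set.Iio 0)) (nhds L)) ↔
      lam = Dp / (Dp + Dm)) := by
  refine ⟨fun t _ x => ⟨_, _, qLam_tendsto_right Dp Dm hDp lam t x,
    qLam_tendsto_left Dp Dm hDm lam t x⟩, ?_, ?_⟩
  · intro h
    obtain ⟨L, hR, hL⟩ := h 1 one_pos 0
    have e1 := tendsto_nhds_unique hR (qLam_tendsto_right Dp Dm hDp lam 1 0)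
    have e2 := tendsto_nhds_unique hL (qLam_tendsto_left Dp Dm hDm lam 1 0)
    exact (alpha_balance_iff Dp Dm hDp hDm lam hlam₀ hlam₁ _
      (gaussKernel_pos 1 _ one_pos)).1 (e1.symm.trans e2)
  · intro h t ht x
    refine ⟨_, qLam_tendsto_right Dp Dm hDp lam t x, ?_⟩
    rw [(alpha_balance_iff Dp Dm hDp hDm lam hlam₀ hlam₁ _ (gaussKernel_pos t _ ht)).2 h]
    exact qLam_tendsto_left Dp Dm hDm lam t x
end

section
/- (Walsh's scale function is harmonic for skew Brownian motion.) Define r_α(y) := (1−α)·y for y ≥ 0 and r_α(y) := α·y for y < 0. Then for every t > 0 and every x ∈ ℝ, ∫_ℝ p^{(α)}(t,x,y)·r_α(y) dy = r_α(x); that is, r_α(B^{(α)}) is a martingale at the level of transition densities. -/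
open MeasureTheory Real Filter Topology

/-- Walsh's scale function `r_α`. -/
noncomputable def walshScale (α y : ℝ) : ℝ := if 0 ≤ y then (1 - α) * y else α * y

lemma gaussKernel_eq (t z : ℝ) :
    gaussKernel t z = (Real.sqrt (2 * Real.pi * t))⁻¹ * Real.exp (-(1 / (2 * t)) * z ^ 2) := by
  unfold gaussKernel
  congr 2
  ring

lemma integrable_gaussKernel {t : ℝ} (ht : 0 < t) : Integrable (gaussKernel t) := by
  have h := (integrable_exp_neg_mul_sq (b := 1 / (2 * t)) (by positivity)).const_mul
    (Real.sqrt (2 * Real.pi * t))⁻¹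
  refine h.congr (Eventually.of_forall fun z => ?_)
  exact (gaussKernel_eq t z).symm

lemma integrable_gaussKernel_mul_id {t : ℝ} (ht : 0 < t) :
    Integrable (fun z => gaussKernel t z * z) := by
  have h := (integrable_mul_exp_neg_mul_sq (b := 1 / (2 * t)) (by positivity)).const_mul
    (Real.sqrt (2 * Real.pi * t))⁻¹
  refine h.congr (Eventually.of_forall fun z => ?_)
  simp only [gaussKernel_eq]
  ring

lemma integral_gaussKernel {t : ℝ} (ht : 0 < t) : ∫ z, gaussKernel t z = 1 := by
  simp only [gaussKernel_eq]
  rw [integral_const_mul, integral_gaussian]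
  have : Real.pi / (1 / (2 * t)) = 2 * Real.pi * t := by field_simp
  rw [this]
  exact inv_mul_cancel₀ (by positivity)

lemma integral_gaussKernel_mul_id (t : ℝ) : ∫ z, gaussKernel t z * z = 0 := by
  have h := integral_neg_eq_self (fun z => gaussKernel t z * z) volume
  simp only [gaussKernel_neg, mul_neg, integral_neg] at h
  linarith

lemma integrable_shift {t : ℝ} (ht : 0 < t) (x : ℝ) :
    Integrable (fun y => gaussKernel t (y - x) * y) := by
  have h := (((integrable_gaussKernel_mul_id ht).add
    ((integrable_gaussKernel ht).mul_const x)).comp_sub_right x)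
  refine h.congr (Eventually.of_forall fun z => ?_)
  simp only [Pi.add_apply]
  ring

lemma integral_shift {t : ℝ} (ht : 0 < t) (x : ℝ) :
    ∫ y, gaussKernel t (y - x) * y = x := by
  have h := integral_sub_right_eq_self (μ := volume)
    (fun z => gaussKernel t z * z + gaussKernel t z * x) x
  rw [integral_add (integrable_gaussKernel_mul_id ht) ((integrable_gaussKernel ht).mul_const x),
    integral_gaussKernel_mul_id, integral_mul_const, integral_gaussKernel ht] at h
  calc _ = _ := by congr 1; ext y; ring
    _ = _ := h
    _ = x := by ring

/-- The half-line first moment. -/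
noncomputable def halfMoment (t x : ℝ) : ℝ := ∫ y in Set.Ioi 0, gaussKernel t (y - x) * y

lemma integral_Iic_shift (t x : ℝ) :
    ∫ y in Set.Iic 0, gaussKernel t (y - x) * y = -halfMoment t (-x) := by
  have h := integral_comp_neg_Ioi (0 : ℝ) (fun y => gaussKernel t (y - x) * y)
  rw [neg_zero] at h
  rw [← h, halfMoment, ← integral_neg]
  congr 1
  ext y
  rw [show -y - x = -(y - -x) by ring, gaussKernel_neg]
  ring

lemma halfMoment_sub {t : ℝ} (ht : 0 < t) (x : ℝ) :
    halfMoment t x - halfMoment t (-x) = x := by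
  have h := integral_add_compl (μ := volume) (measurableSet_Ioi (a := (0 : ℝ)))
    (integrable_shift ht x)
  rw [Set.compl_Ioi, integral_Iic_shift, integral_shift ht] at h
  unfold halfMoment at *
  linarith

/-- Evaluate an integral which is a combination of shifted moments on each half line. -/
lemma integral_piecewise {t : ℝ} (ht : 0 < t) (x a b c d : ℝ) (f : ℝ → ℝ)
    (hp : ∀ y, 0 < y → f y = a * (gaussKernel t (y - x) * y) + b * (gaussKernel t (y - -x) * y))
    (hn : ∀ y, y ≤ 0 → f y = c * (gaussKernel t (y - x) * y) + d * (gaussKernel t (y - -x) * y)) :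
    ∫ y, f y = a * halfMoment t x + b * halfMoment t (-x)
      - c * halfMoment t (-x) - d * halfMoment t x := by
  have i1 := integrable_shift ht x
  have i2 := integrable_shift ht (-x)
  have hp' : Set.EqOn f (fun y => a * (gaussKernel t (y - x) * y)
      + b * (gaussKernel t (y - -x) * y)) (Set.Ioi 0) := fun y hy => hp y hy
  have hn' : Set.EqOn f (fun y => c * (gaussKernel t (y - x) * y)
      + d * (gaussKernel t (y - -x) * y)) (Set.Iic 0) := fun y hy => hn y hy
  have ip : IntegrableOn f (Set.Ioi 0) :=
    (integrableOn_congr_fun hp' measurableSet_Ioi).2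
      ((i1.const_mul a).add (i2.const_mul b)).integrableOn
  have im : IntegrableOn f (Set.Iic 0) :=
    (integrableOn_congr_fun hn' measurableSet_Iic).2
      ((i1.const_mul c).add (i2.const_mul d)).integrableOn
  rw [← intervalIntegral.integral_Iic_add_Ioi im ip, setIntegral_congr_fun measurableSet_Ioi hp',
    setIntegral_congr_fun measurableSet_Iic hn',
    integral_add (i1.const_mul a).integrableOn (i2.const_mul b).integrableOn,
    integral_add (i1.const_mul c).integrableOn (i2.const_mul d).integrableOn]
  simp only [integral_const_mul, integral_Iic_shift, neg_neg]
  unfold halfMoment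
  ring

/-- Walsh's scale function is harmonic for skew Brownian
motion: `r_α(B^{(α)})` is a martingale at the level of transition densities. -/
theorem pSkew_walshScale_harmonic (α : ℝ) (hα₀ : 0 < α) (hα₁ : α < 1)
    (t : ℝ) (ht : 0 < t) (x : ℝ) :
    ∫ y : ℝ, pSkew α t x y * walshScale α y = walshScale α x := by
  have hm := halfMoment_sub ht x
  have hw : ∀ y : ℝ, y ≤ 0 → walshScale α y = α * y := by
    intro y hy
    rcases hy.lt_or_eq with h | h
    · simp [walshScale, not_le.2 h]
    · simp [walshScale, h]
  have hw' : ∀ y : ℝ, 0 ≤ y → walshScale α y = (1 - α) * y := by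
    intro y hy
    simp [walshScale, hy]
  rcases lt_trichotomy x 0 with hx | hx | hx
  · rw [integral_piecewise ht x (2 * α * (1 - α)) 0 α (-(2 * α - 1) * α), hw x hx.le]
    · linear_combination α * hm
    · intro y hy
      rw [hw' y hy.le]
      simp only [pSkew, hx.not_gt, hx, hx.le, hy, hy.not_ge, false_and, and_false, and_true,
        if_true, if_false]
      ring
    · intro y hy
      rw [hw y hy]
      simp only [pSkew, hx.not_gt, hx, hy, false_and, and_true, if_true, if_false, sub_neg_eq_add]
      ring
  · subst hx
    rw [integral_piecewise ht 0 (2 * α * (1 - α)) 0 (2 * (1 - α) * α) 0, hw 0 le_rfl]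
    · rw [neg_zero]
      ring
    · intro y hy
      rw [hw' y hy.le]
      simp only [pSkew, lt_irrefl, le_refl, hy, false_and, and_true, if_true, if_false]
      ring
    · intro y hy
      rw [hw y hy]
      simp only [pSkew, lt_irrefl, hy.not_gt, false_and, and_false, if_false]
      ring
  · rw [integral_piecewise ht x (1 - α) ((2 * α - 1) * (1 - α)) (2 * (1 - α) * α) 0, hw' x hx.le]
    · linear_combination (1 - α) * hm
    · intro y hy
      rw [hw' y hy.le]
      simp only [pSkew, hx, hy, and_true, if_true, sub_neg_eq_add]
      ring
    · intro y hy
      rw [hw y hy]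
      simp only [pSkew, hx.not_gt, hy.not_gt, false_and, and_false, if_false]
      ring
end
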